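/- arXiv:0903.0610 — 2 statements merged into one kernel-verified Lean document; each statement's English description precedes it below -/
import Mathlib

section
/- Suppose φ''_F > 0 and φ''_{2F} ≠ 0. Then there exist N_0 ∈ N and constants C_1 ≥ C_2 > 0 such that for all N ≥ N_0 and all integers K with 2 ≤ K ≤ N/2, −C_1 N^{1/2} ≤ inf { ⟨L^{qcf} v, v⟩ : v ∈ V_0, ‖Dv‖_{ℓ^2_ε} = 1 } ≤ −C_2 N^{1/2}. In particular, for N large enough the linearized force-based QC operator L^{qcf} is not positive semidefinite on V_0. -/
noncomputable def eps (N : ℤ) : ℝ := 1 / (N : ℝ)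

noncomputable def Dd (N : ℤ) (v : ℤ → ℝ) (j : ℤ) : ℝ := (v j - v (j-1)) / eps N

noncomputable def L1op (N : ℤ) (v : ℤ → ℝ) (j : ℤ) : ℝ :=
  (-v (j+1) + 2 * v j - v (j-1)) / (eps N)^2

noncomputable def L2op (N K : ℤ) (v : ℤ → ℝ) (j : ℤ) : ℝ :=
  if -K ≤ j ∧ j ≤ K then (-v (j+2) + 2 * v j - v (j-2)) / (eps N)^2
  else 4 * (-v (j+1) + 2 * v j - v (j-1)) / (eps N)^2

/-- Linearized force-based QC operator `L^{qcf} = φ''_F L₁ + φ''_{2F} L₂`. -/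
noncomputable def Lqcf (N K : ℤ) (φF φ2F : ℝ) (v : ℤ → ℝ) (j : ℤ) : ℝ :=
  φF * L1op N v j + φ2F * L2op N K v j

/-- The Rayleigh-quotient values `⟨L^{qcf}v, v⟩` of `L^{qcf}` over
`{v ∈ V₀ : ‖Dv‖_{ℓ²_ε} = 1}`. -/
noncomputable def rayleighSet (N K : ℤ) (φF φ2F : ℝ) : Set ℝ :=
  { x | ∃ v : ℤ → ℝ, v (-N) = 0 ∧ v N = 0 ∧
    Real.sqrt (eps N * ∑ j ∈ Finset.Icc (-N+1) N, (Dd N v j)^2) = 1 ∧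
    x = eps N * ∑ j ∈ Finset.Icc (-N+1) (N-1), Lqcf N K φF φ2F v j * v j }

noncomputable def QSum (N : ℤ) (v : ℤ → ℝ) : ℝ := ∑ j ∈ Finset.Icc (-N+1) N, (v j - v (j-1))^2

noncomputable def QB (K : ℤ) (v : ℤ → ℝ) : ℝ := ∑ j ∈ Finset.Icc (-K) K,
  (v (j+2) - 4 * v (j+1) + 6 * v j - 4 * v (j-1) + v (j-2)) * v j

lemma q_insert (a b : ℤ) (h : a ≤ b + 1) :
    Finset.Icc a (b+1) = insert (b+1) (Finset.Icc a b) := by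
  ext x; simp only [Finset.mem_insert, Finset.mem_Icc]; omega

lemma q_tele (f : ℤ → ℝ) (a b : ℤ) (h : a ≤ b) :
    ∑ j ∈ Finset.Icc (a+1) b, (f j - f (j-1)) = f b - f a := by
  induction b, h using Int.le_induction with
  | base => simp
  | succ b hb ih =>
    rw [q_insert _ _ (by omega), Finset.sum_insert (by simp), ih]
    rw [show b + 1 - 1 = b by ring]; ring

lemma q_first (N : ℤ) (v : ℤ → ℝ) (hN : 1 ≤ N) (h1 : v (-N) = 0) (h2 : v N = 0) :
    ∑ j ∈ Finset.Icc (-N+1) (N-1), (-v (j+1) + 2 * v j - v (j-1)) * v j = QSum N v := by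
  have e : ∀ j ∈ Finset.Icc (-N+1) (N-1), (-v (j+1) + 2 * v j - v (j-1)) * v j =
      (v j - v (j-1))^2 - ((fun i => (v (i+1) - v i) * v i) j
        - (fun i => (v (i+1) - v i) * v i) (j-1)) := by
    intro j _
    simp only [sub_add_cancel]; ring
  rw [Finset.sum_congr rfl e, Finset.sum_sub_distrib, q_tele _ _ _ (by omega)]
  unfold QSum
  have := q_insert (-N+1) (N-1) (by omega)
  rw [sub_add_cancel] at this
  rw [this, Finset.sum_insert (by simp)]
  simp only [sub_add_cancel, h1, h2]; ring

lemma q_second (K : ℤ) (v : ℤ → ℝ) (hK : 0 ≤ K) :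
    QB K v = ∑ j ∈ Finset.Icc (-K) K, (v (j+1) - 2 * v j + v (j-1))^2
      + ((v (K+2) - 2 * v (K+1) + v K) * v K - (v (K+1) - 2 * v K + v (K-1)) * v (K+1))
      - ((v (-K+1) - 2 * v (-K) + v (-K-1)) * v (-K-1)
          - (v (-K) - 2 * v (-K-1) + v (-K-2)) * v (-K)) := by
  have e : ∀ j ∈ Finset.Icc (-K) K,
      (v (j+2) - 4 * v (j+1) + 6 * v j - 4 * v (j-1) + v (j-2)) * v j =
      (v (j+1) - 2 * v j + v (j-1))^2 +
       ((fun j => (v (j+2) - 2 * v (j+1) + v j) * v j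
          - (v (j+1) - 2 * v j + v (j-1)) * v (j+1)) j
        - (fun j => (v (j+2) - 2 * v (j+1) + v j) * v j
          - (v (j+1) - 2 * v j + v (j-1)) * v (j+1)) (j-1)) := by
    intro j _
    simp only [sub_add_cancel, show j - 1 + 2 = j + 1 by ring, show j - 1 - 1 = j - 2 by ring]; ring
  unfold QB
  have t := q_tele (fun j => (v (j+2) - 2 * v (j+1) + v j) * v j
          - (v (j+1) - 2 * v j + v (j-1)) * v (j+1)) (-K-1) K (by omega)
  rw [sub_add_cancel] at t
  rw [Finset.sum_congr rfl e, Finset.sum_add_distrib, t]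
  simp only [sub_add_cancel, show -K - 1 + 2 = -K + 1 by ring, show -K - 1 - 1 = -K - 2 by ring]
  ring

lemma q_form (N K : ℤ) (φF φ2F : ℝ) (v : ℤ → ℝ) (hN : 1 ≤ N) (hK : K ≤ N - 1)
    (h1 : v (-N) = 0) (h2 : v N = 0) :
    eps N * ∑ j ∈ Finset.Icc (-N+1) (N-1), Lqcf N K φF φ2F v j * v j
      = N * ((φF + 4 * φ2F) * QSum N v - φ2F * QB K v) := by
  have hN0 : (N : ℝ) ≠ 0 := by exact_mod_cast (by omega : N ≠ 0)
  have e : ∀ j ∈ Finset.Icc (-N+1) (N-1), Lqcf N K φF φ2F v j * v j =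
      (N:ℝ)^2 * ((φF + 4 * φ2F) * ((-v (j+1) + 2 * v j - v (j-1)) * v j)
       - φ2F * (if -K ≤ j ∧ j ≤ K then
        (v (j+2) - 4 * v (j+1) + 6 * v j - 4 * v (j-1) + v (j-2)) * v j else 0)) := by
    intro j _
    unfold Lqcf L1op L2op eps
    split_ifs <;> field_simp <;> ring
  rw [Finset.sum_congr rfl e, ← Finset.mul_sum, Finset.sum_sub_distrib, ← Finset.mul_sum,
    ← Finset.mul_sum, q_first N v hN h1 h2, ← Finset.sum_filter]
  have : Finset.filter (fun j => -K ≤ j ∧ j ≤ K) (Finset.Icc (-N+1) (N-1)) = Finset.Icc (-K) K := by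
    ext x; simp only [Finset.mem_filter, Finset.mem_Icc]; omega
  rw [this]
  change eps N * ((N:ℝ)^2 * ((φF + 4 * φ2F) * QSum N v - φ2F * QB K v)) = _
  unfold eps
  field_simp

lemma q_norm (N : ℤ) (v : ℤ → ℝ) (hN : 1 ≤ N) :
    eps N * ∑ j ∈ Finset.Icc (-N+1) N, (Dd N v j)^2 = N * QSum N v := by
  have hN0 : (N : ℝ) ≠ 0 := by exact_mod_cast (by omega : N ≠ 0)
  unfold QSum
  rw [Finset.mul_sum, Finset.mul_sum]
  refine Finset.sum_congr rfl fun j _ => ?_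
  unfold Dd eps
  field_simp

lemma q_diff (N : ℤ) (v : ℤ → ℝ) (j : ℤ) (h : -N + 1 ≤ j) (h' : j ≤ N) :
    (v j - v (j-1))^2 ≤ QSum N v :=
  Finset.single_le_sum (f := fun j => (v j - v (j-1))^2) (fun i _ => sq_nonneg _)
    (Finset.mem_Icc.2 ⟨h, h'⟩)

lemma q_val (N : ℤ) (v : ℤ → ℝ) (h1 : v (-N) = 0) (j : ℤ) (h : -N ≤ j) (h' : j ≤ N) :
    (v j)^2 ≤ 2 * N * QSum N v := by
  have t := q_tele v (-N) j h
  rw [h1, sub_zero] at t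
  rw [← t]
  refine (sq_sum_le_card_mul_sum_sq).trans ?_
  have hN : (0:ℝ) ≤ N := by exact_mod_cast (by omega : 0 ≤ N)
  refine mul_le_mul ?_ ?_ (Finset.sum_nonneg fun i _ => sq_nonneg _) (by positivity)
  · rw [Int.card_Icc]
    have : (((j + 1 - (-N+1)).toNat : ℤ)) ≤ 2 * N := by omega
    exact_mod_cast this
  · exact Finset.sum_le_sum_of_subset_of_nonneg (Finset.Icc_subset_Icc le_rfl h')
      fun i _ _ => sq_nonneg _

lemma q_w (N K : ℤ) (v : ℤ → ℝ) (hK : K ≤ N - 1) :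
    ∑ j ∈ Finset.Icc (-K) K, (v (j+1) - 2 * v j + v (j-1))^2 ≤ 4 * QSum N v := by
  have e : ∀ j ∈ Finset.Icc (-K) K, (v (j+1) - 2 * v j + v (j-1))^2 ≤
      2 * (v (j+1) - v (j+1-1))^2 + 2 * (v j - v (j-1))^2 := by
    intro j _
    rw [add_sub_cancel_right]
    nlinarith [sq_nonneg (v (j+1) - v j + (v j - v (j-1)))]
  refine (Finset.sum_le_sum e).trans ?_
  rw [Finset.sum_add_distrib, ← Finset.mul_sum, ← Finset.mul_sum]
  have a : ∑ j ∈ Finset.Icc (-K) K, (v j - v (j-1))^2 ≤ QSum N v :=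
    Finset.sum_le_sum_of_subset_of_nonneg (Finset.Icc_subset_Icc (by omega) (by omega))
      fun i _ _ => sq_nonneg _
  have b : ∑ j ∈ Finset.Icc (-K) K, (v (j+1) - v (j+1-1))^2 ≤ QSum N v := by
    have : ∑ j ∈ Finset.Icc (-K) K, (v (j+1) - v (j+1-1))^2
      = ∑ j ∈ (Finset.Icc (-K) K).map (addRightEmbedding 1), (v j - v (j-1))^2 := by
      rw [Finset.sum_map]; rfl
    rw [this, Finset.map_add_right_Icc]
    exact Finset.sum_le_sum_of_subset_of_nonneg (Finset.Icc_subset_Icc (by omega) (by omega))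
      fun i _ _ => sq_nonneg _
  linarith

/-- boundary term estimate -/
lemma q_bdry (a b c x s : ℝ) (hs : 0 ≤ s) (ha : |a| ≤ s) (hb : |b| ≤ s) (hc : |c| ≤ s)
    (hx : |x| ≤ 2) : |(c - 2 * b + a) * x - (b - a) * b| ≤ 8 * s + 2 * s ^ 2 := by
  have h1 : |c - 2 * b + a| ≤ 4 * s := by
    rw [abs_le] at *; constructor <;> linarith [ha.1, ha.2, hb.1, hb.2, hc.1, hc.2]
  have h2 : |b - a| ≤ 2 * s := by
    rw [abs_le] at *; constructor <;> linarith [ha.1, ha.2, hb.1, hb.2, hc.1, hc.2]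
  calc _ ≤ |(c - 2 * b + a) * x| + |(b - a) * b| := abs_sub _ _
    _ = |c - 2 * b + a| * |x| + |b - a| * |b| := by rw [abs_mul, abs_mul]
    _ ≤ (4 * s) * 2 + (2 * s) * s := by gcongr
    _ = _ := by ring

lemma q_Bbound (N K : ℤ) (v : ℤ → ℝ) (hK : 0 ≤ K) (hKN : K + 2 ≤ N)
    (h1 : v (-N) = 0) (hS : N * QSum N v = 1) :
    |QB K v| ≤ 8 * QSum N v + 16 * Real.sqrt (QSum N v) := by
  have hS0 : 0 ≤ QSum N v := Finset.sum_nonneg fun i _ => sq_nonneg _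
  set s := Real.sqrt (QSum N v) with hs
  have hs0 : 0 ≤ s := Real.sqrt_nonneg _
  have hss : s ^ 2 = QSum N v := Real.sq_sqrt hS0
  have hd : ∀ j, -N + 1 ≤ j → j ≤ N → |v j - v (j-1)| ≤ s := fun j h h' =>
    Real.abs_le_sqrt (q_diff N v j h h')
  have hv : ∀ j, -N ≤ j → j ≤ N → |v j| ≤ 2 := fun j h h' => by
    have := q_val N v h1 j h h'
    apply abs_le_of_sq_le_sq _ (by norm_num)
    nlinarith
  have w0 : 0 ≤ ∑ j ∈ Finset.Icc (-K) K, (v (j+1) - 2 * v j + v (j-1))^2 :=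
    Finset.sum_nonneg fun i _ => sq_nonneg _
  have w1 := q_w N K v (by omega)
  rw [q_second K v hK]
  have b1 := q_bdry (v K - v (K-1)) (v (K+1) - v K) (v (K+2) - v (K+1)) (v K) s hs0
    (hd K (by omega) (by omega))
    (by have := hd (K+1) (by omega) (by omega); rwa [add_sub_cancel_right] at this)
    (by have := hd (K+2) (by omega) (by omega); rwa [show K + 2 - 1 = K + 1 by ring] at this)
    (hv K (by omega) (by omega))
  have b2 := q_bdry (v (-K) - v (-K+1)) (v (-K-1) - v (-K)) (v (-K-2) - v (-K-1)) (v (-K)) s hs0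
    (by have := hd (-K+1) (by omega) (by omega)
        rwa [add_sub_cancel_right, abs_sub_comm] at this)
    (by have := hd (-K) (by omega) (by omega); rwa [abs_sub_comm] at this)
    (by have := hd (-K-1) (by omega) (by omega)
        rwa [abs_sub_comm, show -K - 1 - 1 = -K - 2 by ring] at this)
    (hv (-K) (by omega) (by omega))
  rw [← hss] at w1 ⊢
  rw [abs_le] at *
  constructor <;> nlinarith [b1.1, b1.2, b2.1, b2.2]

/-- The test function. -/
noncomputable def qv (N K : ℤ) (t : ℝ) (j : ℤ) : ℝ :=
  ((if j ≤ 0 then 1 + (j:ℝ) / N else 1 - (j:ℝ) / N) + (if j = K + 2 then t else 0)) / 2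

lemma qv_sum (N K : ℤ) (t : ℝ) (hK : 0 ≤ K) (hKN : K + 3 ≤ N) :
    QSum N (qv N K t) = (2 / N + 2 * t ^ 2) / 4 := by
  have hN0 : (N : ℝ) ≠ 0 := by exact_mod_cast (by omega : N ≠ 0)
  have e : ∀ j ∈ Finset.Icc (-N+1) N, (qv N K t j - qv N K t (j-1))^2 =
      1 / (4 * (N:ℝ)^2) + (if j = K + 2 then t^2/4 - t / (2 * N) else 0)
        + (if j = K + 3 then t^2/4 + t / (2 * N) else 0) := by
    intro j _
    unfold qv
    have c1 : (j - 1 = K + 2) ↔ (j = K + 3) := by omega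
    simp only [c1]
    push_cast
    by_cases hj : j ≤ 0
    · rw [if_pos hj, if_pos (show j - 1 ≤ 0 by omega), if_neg (show ¬ j = K + 2 by omega),
        if_neg (show ¬ j = K + 3 by omega), if_neg (show ¬ j = K + 2 by omega),
        if_neg (show ¬ j = K + 3 by omega)]
      field_simp; ring
    · by_cases hj1 : j - 1 ≤ 0
      · have : j = 1 := by omega
        subst this
        rw [if_neg hj, if_pos hj1, if_neg (by omega), if_neg (by omega), if_neg (by omega),
          if_neg (by omega)]
        push_cast
        field_simp; ring
      · rw [if_neg hj, if_neg hj1]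
        split_ifs
        · omega
        all_goals (field_simp; ring)
  unfold QSum
  rw [Finset.sum_congr rfl e, Finset.sum_add_distrib, Finset.sum_add_distrib,
    Finset.sum_ite_eq', Finset.sum_ite_eq', if_pos (Finset.mem_Icc.2 ⟨by omega, by omega⟩),
    if_pos (Finset.mem_Icc.2 ⟨by omega, by omega⟩), Finset.sum_const, Int.card_Icc, nsmul_eq_mul]
  have : ((N + 1 - (-N+1)).toNat : ℝ) = 2 * N := by
    have : (((N + 1 - (-N+1)).toNat : ℤ)) = 2 * N := by omega
    exact_mod_cast this
  rw [this]
  field_simp; ring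

lemma qv_B (N K : ℤ) (t : ℝ) (hK : 2 ≤ K) (hKN : K + 3 ≤ N) :
    QB K (qv N K t) = (4 / (N:ℝ)^2 + t * (1 - K / N)) / 4 := by
  have hN0 : (N : ℝ) ≠ 0 := by exact_mod_cast (by omega : N ≠ 0)
  have e : ∀ j ∈ Finset.Icc (-K) K,
      (qv N K t (j+2) - 4 * qv N K t (j+1) + 6 * qv N K t j - 4 * qv N K t (j-1)
        + qv N K t (j-2)) * qv N K t j =
      (if j = -1 then -(2 / N) * (1 - 1 / (N:ℝ)) / 4 else 0) + (if j = 0 then 1 / (N:ℝ) else 0)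
        + (if j = 1 then -(2 / N) * (1 - 1 / (N:ℝ)) / 4 else 0)
        + (if j = K then t * (1 - K / N) / 4 else 0) := by
    intro j hj
    rw [Finset.mem_Icc] at hj
    unfold qv
    rw [if_neg (show ¬ j + 1 = K + 2 by omega), if_neg (show ¬ j = K + 2 by omega),
      if_neg (show ¬ j - 1 = K + 2 by omega), if_neg (show ¬ j - 2 = K + 2 by omega)]
    have c1 : (j + 2 = K + 2) ↔ (j = K) := by omega
    simp only [c1]
    push_cast
    rcases (by omega : j ≤ -2 ∨ j = -1 ∨ j = 0 ∨ j = 1 ∨ (2 ≤ j ∧ j < K) ∨ j = K) with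
      h | h | h | h | h | h
    · rw [if_pos (show j + 2 ≤ 0 by omega), if_pos (show j + 1 ≤ 0 by omega),
        if_pos (show j ≤ 0 by omega), if_pos (show j - 1 ≤ 0 by omega),
        if_pos (show j - 2 ≤ 0 by omega), if_neg (show ¬ j = -1 by omega),
        if_neg (show ¬ j = 0 by omega), if_neg (show ¬ j = 1 by omega)]
      simp only [if_neg (show ¬ j = K by omega)]
      ring
    · have : ¬ (-1 = K) := by omega
      subst h; norm_num [this]; field_simp; ring
    · have : ¬ (0 = K) := by omega
      subst h; norm_num [this]; field_simp; ring
    · have : ¬ (1 = K) := by omega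
      subst h; norm_num [this]; field_simp; ring
    · rw [if_neg (show ¬ j + 2 ≤ 0 by omega), if_neg (show ¬ j + 1 ≤ 0 by omega),
        if_neg (show ¬ j ≤ 0 by omega), if_neg (show ¬ j - 1 ≤ 0 by omega),
        if_neg (show ¬ j = -1 by omega),
        if_neg (show ¬ j = 0 by omega), if_neg (show ¬ j = 1 by omega)]
      simp only [if_neg (show ¬ j = K by omega)]
      by_cases hj2 : j = 2
      · subst hj2; norm_num; left; ring
      rw [if_neg (show ¬ j - 2 ≤ 0 by omega)]
      ring
    · subst h
      simp only [if_true]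
      rw [if_neg (by omega), if_neg (by omega), if_neg (by omega)]
      by_cases hj2 : j = 2
      · subst hj2; norm_num; field_simp; ring
      · rw [if_neg (by omega), if_neg (by omega), if_neg (by omega), if_neg (by omega),
          if_neg (by omega)]
        ring
  unfold QB
  rw [Finset.sum_congr rfl e]
  simp only [Finset.sum_add_distrib, Finset.sum_ite_eq']
  rw [if_pos (Finset.mem_Icc.2 ⟨by omega, by omega⟩),
    if_pos (Finset.mem_Icc.2 ⟨by omega, by omega⟩), if_pos (Finset.mem_Icc.2 ⟨by omega, by omega⟩),
    if_pos (Finset.mem_Icc.2 ⟨by omega, by omega⟩)]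
  field_simp; ring

lemma q_lower (N K : ℤ) (φF φ2F : ℝ) (hF : 0 < φF) (hK : 2 ≤ K) (hKN : 2 * K ≤ N) (x : ℝ)
    (hx : x ∈ rayleighSet N K φF φ2F) : -(φF + 28 * |φ2F|) * Real.sqrt N ≤ x := by
  obtain ⟨v, h1, h2, h3, rfl⟩ := hx
  rw [q_norm N v (by omega), Real.sqrt_eq_one] at h3
  rw [q_form N K φF φ2F v (by omega) (by omega) h1 h2]
  have hB := q_Bbound N K v (by omega) (by omega) h1 h3
  have hN1 : (1:ℝ) ≤ N := by exact_mod_cast (by omega : 1 ≤ N)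
  have hr1 : 1 ≤ Real.sqrt N := Real.one_le_sqrt.2 hN1
  have hrr : Real.sqrt N ^ 2 = N := Real.sq_sqrt (by linarith)
  have hS : QSum N v = 1 / N := by field_simp; linarith
  have hs : Real.sqrt (QSum N v) = 1 / Real.sqrt N := by
    rw [hS, Real.sqrt_div zero_le_one, Real.sqrt_one]
  rw [hs] at hB
  set r := Real.sqrt N
  have hNB : |N * QB K v| ≤ 8 + 16 * r := by
    rw [abs_mul, abs_of_pos (by linarith : (0:ℝ) < N)]
    calc (N:ℝ) * |QB K v| ≤ N * (8 * QSum N v + 16 * (1 / r)) := by gcongr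
      _ = 8 * (N * QSum N v) + 16 * (r ^ 2 * (1 / r)) := by rw [hrr]; ring
      _ = 8 + 16 * r := by rw [h3]; field_simp
  have : |φ2F * (N * QB K v)| ≤ |φ2F| * (8 + 16 * r) := by
    rw [abs_mul]; gcongr
  have e : (N:ℝ) * ((φF + 4 * φ2F) * QSum N v - φ2F * QB K v) =
    (φF + 4 * φ2F) * (N * QSum N v) - φ2F * (N * QB K v) := by ring
  rw [e, h3]
  have := (abs_le.1 this).2
  have a1 := neg_abs_le φ2F
  have a2 := abs_nonneg φ2F
  nlinarith

lemma q_upper (N K : ℤ) (φF φ2F : ℝ) (hF : 0 < φF) (h2F : φ2F ≠ 0) (hK : 2 ≤ K)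
    (hKN : 2 * K ≤ N) (h6 : 6 ≤ N) (hbig : 16 * (φF + 5 * |φ2F|) / |φ2F| ≤ Real.sqrt N) :
    ∃ v : ℤ → ℝ, v (-N) = 0 ∧ v N = 0 ∧
      Real.sqrt (eps N * ∑ j ∈ Finset.Icc (-N+1) N, (Dd N v j)^2) = 1 ∧
      eps N * ∑ j ∈ Finset.Icc (-N+1) (N-1), Lqcf N K φF φ2F v j * v j
        ≤ -(|φ2F| / 16) * Real.sqrt N := by
  have hN1 : (1:ℝ) ≤ N := by exact_mod_cast (by omega : 1 ≤ N)
  have hN0 : (N : ℝ) ≠ 0 := by linarith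
  have hr1 : 1 ≤ Real.sqrt N := Real.one_le_sqrt.2 hN1
  have hrr : Real.sqrt N ^ 2 = N := Real.sq_sqrt (by linarith)
  set r := Real.sqrt N
  have hr0 : r ≠ 0 := by linarith
  have ha : 0 < |φ2F| := abs_pos.2 h2F
  obtain ⟨σ, hσ, hσφ⟩ : ∃ σ : ℝ, σ ^ 2 = 1 ∧ φ2F * σ = |φ2F| := by
    rcases le_total 0 φ2F with h | h
    · exact ⟨1, by norm_num, by rw [abs_of_nonneg h]; ring⟩
    · exact ⟨-1, by norm_num, by rw [abs_of_nonpos h]; ring⟩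
  have hz1 : qv N K (σ / r) (-N) = 0 := by
    unfold qv; rw [if_pos (by omega), if_neg (by omega)]; push_cast; field_simp; ring
  have hz2 : qv N K (σ / r) N = 0 := by
    unfold qv; rw [if_neg (by omega), if_neg (by omega)]; field_simp; ring
  have hS : N * QSum N (qv N K (σ / r)) = 1 := by
    rw [qv_sum N K _ (by omega) (by omega), div_pow, hσ, hrr]; field_simp; ring
  refine ⟨qv N K (σ / r), hz1, hz2, ?_, ?_⟩
  · rw [q_norm N _ (by omega), hS, Real.sqrt_one]
  · rw [q_form N K φF φ2F _ (by omega) (by omega) hz1 hz2]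
    have e : (N:ℝ) * ((φF + 4 * φ2F) * QSum N (qv N K (σ / r)) - φ2F * QB K (qv N K (σ / r))) =
      (φF + 4 * φ2F) * (N * QSum N (qv N K (σ / r))) - φ2F * (N * QB K (qv N K (σ / r))) := by ring
    rw [e, hS, qv_B N K _ hK (by omega)]
    have e2 : φ2F * (N * ((4 / (N:ℝ)^2 + σ / r * (1 - K / N)) / 4)) =
        φ2F / N + (φ2F * σ) * r * (1 - K / N) / 4 := by
      have : (N:ℝ) * (σ / r) = σ * r := by rw [← hrr]; field_simp
      calc _ = φ2F * (N * (4 / (N:ℝ)^2)) / 4 + φ2F * (N * (σ / r)) * (1 - K / N) / 4 := by ring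
        _ = _ := by rw [this]; field_simp
    rw [e2, hσφ]
    have hk : (1:ℝ)/2 ≤ 1 - K / N := by
      have : (2:ℝ) * K ≤ N := by exact_mod_cast hKN
      have : (K:ℝ) / N ≤ 1 / 2 := by rw [div_le_iff₀ (by linarith)]; linarith
      linarith
    have h5 : -|φ2F| ≤ φ2F / N := by
      have : |φ2F / N| ≤ |φ2F| := by
        rw [abs_div, abs_of_pos (by linarith : (0:ℝ) < N)]
        exact div_le_self ha.le hN1
      linarith [neg_abs_le (φ2F / N)]
    have h7 : |φ2F| * r * (1 / 2) ≤ |φ2F| * r * (1 - K / N) := by gcongr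
    rw [div_le_iff₀ ha] at hbig
    linarith [le_abs_self φ2F]

/-- Lack of coercivity of `L^{qcf}`: for `φ''_F > 0`, `φ''_{2F} ≠ 0` there are
`N₀` and `C₁ ≥ C₂ > 0` with
`-C₁ N^{1/2} ≤ inf_{v ∈ V₀, ‖Dv‖_{ℓ²_ε}=1} ⟨L^{qcf}v, v⟩ ≤ -C₂ N^{1/2}`
whenever `N ≥ N₀` and `2 ≤ K ≤ N/2`; in particular `L^{qcf}` is not positive
semidefinite for large `N`. -/
theorem Lqcf_not_coercive (φF φ2F : ℝ) (hF : 0 < φF) (h2F : φ2F ≠ 0) :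
    ∃ N0 : ℤ, ∃ C1 C2 : ℝ, 0 < C2 ∧ C2 ≤ C1 ∧
      ∀ N K : ℤ, N0 ≤ N → 2 ≤ K → 2 * K ≤ N →
        (-C1 * Real.sqrt (N : ℝ) ≤ sInf (rayleighSet N K φF φ2F) ∧
          sInf (rayleighSet N K φF φ2F) ≤ -C2 * Real.sqrt (N : ℝ)) ∧
        ∃ v : ℤ → ℝ, v (-N) = 0 ∧ v N = 0 ∧
          eps N * ∑ j ∈ Finset.Icc (-N+1) (N-1), Lqcf N K φF φ2F v j * v j < 0 := by
  obtain ⟨n, hn⟩ := exists_nat_ge ((16 * (φF + 5 * |φ2F|) / |φ2F|) ^ 2)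
  have ha : 0 < |φ2F| := abs_pos.2 h2F
  refine ⟨max 6 n, φF + 28 * |φ2F|, |φ2F| / 16, by positivity, by linarith, ?_⟩
  intro N K hN hK hKN
  have h6 : 6 ≤ N := (le_max_left _ _).trans hN
  have hn' : (n : ℤ) ≤ N := (le_max_right _ _).trans hN
  have hn2 : (n : ℝ) ≤ N := by exact_mod_cast hn'
  have hN0 : (0:ℝ) < N := by exact_mod_cast (by omega : 0 < N)
  obtain ⟨v, h1, h2, h3, h4⟩ := q_upper N K φF φ2F hF h2F hK hKN h6
    (Real.le_sqrt_of_sq_le (hn.trans hn2))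
  have hmem : eps N * ∑ j ∈ Finset.Icc (-N+1) (N-1), Lqcf N K φF φ2F v j * v j
    ∈ rayleighSet N K φF φ2F := ⟨v, h1, h2, h3, rfl⟩
  have hlow := q_lower N K φF φ2F hF hK hKN
  refine ⟨⟨le_csInf ⟨_, hmem⟩ hlow, (csInf_le ⟨_, hlow⟩ hmem).trans h4⟩, v, h1, h2, ?_⟩
  have : 0 < |φ2F| / 16 * Real.sqrt N := by positivity
  linarith
end

section
/- The conjugate matrix E^{qcf} of the linearized force-based QC operator satisfies min_i ((E^{qcf})_{ii} + Σ_{j≠i} min(0,(E^{qcf})_{ij})) − max_i Σ_{j≠i} max(0,(E^{qcf})_{ij}) = φ''_F + 8φ''_{2F}, provided φ''_F > 0 and φ''_{2F} < 0. -/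
set_option linter.unusedSimpArgs false

/-- The matrix `B` such that `E^{qcf} = φ''_F I + φ''_{2F} B`, with rows/columns
indexed by `{-N+1,…,N}` and atomistic region `{-K,…,K}`. -/
noncomputable def Bqcf (K : ℤ) (i j : ℤ) : ℝ :=
  if i ≤ -K - 1 then
    (if j = i then 4 else if j = -K then 1 else if j = -K+1 then -2
      else if j = -K+2 then 1 else 0)
  else if i = -K then
    (if j = i then 5 else if j = -K+1 then -2 else if j = -K+2 then 1 else 0)
  else if i ≤ K then
    (if j = i-1 then 1 else if j = i then 2 else if j = i+1 then 1 else 0)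
  else if i = K+1 then
    (if j = K-1 then 1 else if j = K then -2 else if j = i then 5 else 0)
  else
    (if j = K-1 then 1 else if j = K then -2 else if j = K+1 then 1
      else if j = i then 4 else 0)

/-- The conjugate matrix `E^{qcf} = φ''_F I + φ''_{2F} B`. -/
noncomputable def Eqcf (K : ℤ) (φF φ2F : ℝ) (i j : ℤ) : ℝ :=
  φF * (if i = j then 1 else 0) + φ2F * Bqcf K i j

/-- Row sums of the negative and positive parts from an explicit description of a row. -/
lemma row_two (S : Finset ℤ) (i a b c : ℤ) (t : ℝ) (f : ℤ → ℝ) (g : ℤ → ℝ) (s : ℝ)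
    (ha : a ∈ S.erase i) (hb : b ∈ S.erase i) (hc : c ∈ S.erase i)
    (hf : ∀ j, j ≠ i → f j = (if j = a then t else 0) + (if j = b then t else 0))
    (hg : ∀ j, j ≠ i → g j = (if j = c then s else 0)) :
    ∑ j ∈ S.erase i, f j = 2 * t ∧ ∑ j ∈ S.erase i, g j = s := by
  constructor
  · rw [Finset.sum_congr rfl (fun j hj => hf j (Finset.ne_of_mem_erase hj)),
      Finset.sum_add_distrib, Finset.sum_ite_eq', Finset.sum_ite_eq', if_pos ha, if_pos hb]
    ring
  · rw [Finset.sum_congr rfl (fun j hj => hg j (Finset.ne_of_mem_erase hj)),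
      Finset.sum_ite_eq', if_pos hc]

lemma row_one (S : Finset ℤ) (i a c : ℤ) (t : ℝ) (f : ℤ → ℝ) (g : ℤ → ℝ) (s : ℝ)
    (ha : a ∈ S.erase i) (hc : c ∈ S.erase i)
    (hf : ∀ j, j ≠ i → f j = (if j = a then t else 0))
    (hg : ∀ j, j ≠ i → g j = (if j = c then s else 0)) :
    ∑ j ∈ S.erase i, f j = t ∧ ∑ j ∈ S.erase i, g j = s := by
  constructor
  · rw [Finset.sum_congr rfl (fun j hj => hf j (Finset.ne_of_mem_erase hj)),
      Finset.sum_ite_eq', if_pos ha]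
  · rw [Finset.sum_congr rfl (fun j hj => hg j (Finset.ne_of_mem_erase hj)),
      Finset.sum_ite_eq', if_pos hc]

/-- The two row quantities, for every row. -/
lemma Eqcf_rows (N K : ℤ) (hK : 2 ≤ K) (hKN : 2 * K ≤ N)
    (φF φ2F : ℝ) (h2F : φ2F < 0) (i : ℤ) (hi : i ∈ Finset.Icc (-N+1) N) :
    ((i ≤ -K ∨ K + 1 ≤ i) ∧ Eqcf K φF φ2F i i +
          ∑ j ∈ (Finset.Icc (-N+1) N).erase i, min 0 (Eqcf K φF φ2F i j) = φF + 6 * φ2F ∧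
        ∑ j ∈ (Finset.Icc (-N+1) N).erase i, max 0 (Eqcf K φF φ2F i j) = -2 * φ2F) ∨
    ((-K < i ∧ i ≤ K) ∧ Eqcf K φF φ2F i i +
          ∑ j ∈ (Finset.Icc (-N+1) N).erase i, min 0 (Eqcf K φF φ2F i j) = φF + 4 * φ2F ∧
        ∑ j ∈ (Finset.Icc (-N+1) N).erase i, max 0 (Eqcf K φF φ2F i j) = 0) := by
  have m1 : min 0 φ2F = φ2F := min_eq_right h2F.le
  have m2 : min 0 (φ2F * -2) = 0 := min_eq_left (by linarith)
  have m3 : max 0 φ2F = 0 := max_eq_left h2F.le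
  have m4 : max 0 (φ2F * -2) = -2 * φ2F := by rw [max_eq_right (by linarith)]; ring
  rw [Finset.mem_Icc] at hi
  have hmem : ∀ a, (-N+1 ≤ a ∧ a ≤ N) → a ≠ i → a ∈ (Finset.Icc (-N+1) N).erase i :=
    fun a h1 h2 => Finset.mem_erase.2 ⟨h2, Finset.mem_Icc.2 h1⟩
  rcases lt_trichotomy i (-K) with h | h | h
  · left
    have hrow : ∀ j, j ≠ i → Eqcf K φF φ2F i j = φ2F * (if j = -K then 1 else
        if j = -K+1 then -2 else if j = -K+2 then 1 else 0) := by
      intro j hj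
      simp only [Eqcf, Bqcf, if_pos (show i ≤ -K - 1 by omega), if_neg hj, if_neg hj.symm]
      ring
    have hd : Eqcf K φF φ2F i i = φF + 4 * φ2F := by
      simp only [Eqcf, Bqcf, if_pos (show i ≤ -K - 1 by omega), if_true]
      ring
    obtain ⟨e1, e2⟩ := row_two (Finset.Icc (-N+1) N) i (-K) (-K+2) (-K+1) φ2F
      (fun j => min 0 (Eqcf K φF φ2F i j)) (fun j => max 0 (Eqcf K φF φ2F i j)) (-2 * φ2F)
      (hmem _ (by omega) (by omega)) (hmem _ (by omega) (by omega))
      (hmem _ (by omega) (by omega))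
      (by intro j hj; simp only [hrow j hj]; split_ifs <;> first | omega | simp only [mul_one, mul_zero, add_zero, zero_add, min_self, max_self, m1, m2, m3, m4])
      (by intro j hj; simp only [hrow j hj]; split_ifs <;> first | omega | simp only [mul_one, mul_zero, add_zero, zero_add, min_self, max_self, m1, m2, m3, m4])
    refine ⟨by omega, ?_, e2⟩
    rw [e1, hd]; ring
  · left
    have hrow : ∀ j, j ≠ i → Eqcf K φF φ2F i j = φ2F * (
        if j = -K+1 then -2 else if j = -K+2 then 1 else 0) := by
      intro j hj
      simp only [Eqcf, Bqcf, if_neg (show ¬ i ≤ -K - 1 by omega), if_pos h, if_neg hj,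
        if_neg hj.symm]
      ring
    have hd : Eqcf K φF φ2F i i = φF + 5 * φ2F := by
      simp only [Eqcf, Bqcf, if_neg (show ¬ i ≤ -K - 1 by omega), if_pos h, if_true]
      ring
    obtain ⟨e1, e2⟩ := row_one (Finset.Icc (-N+1) N) i (-K+2) (-K+1) φ2F
      (fun j => min 0 (Eqcf K φF φ2F i j)) (fun j => max 0 (Eqcf K φF φ2F i j)) (-2 * φ2F)
      (hmem _ (by omega) (by omega)) (hmem _ (by omega) (by omega))
      (by intro j hj; simp only [hrow j hj]; split_ifs <;> first | omega | simp only [mul_one, mul_zero, add_zero, zero_add, min_self, max_self, m1, m2, m3, m4])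
      (by intro j hj; simp only [hrow j hj]; split_ifs <;> first | omega | simp only [mul_one, mul_zero, add_zero, zero_add, min_self, max_self, m1, m2, m3, m4])
    refine ⟨by omega, ?_, e2⟩
    rw [e1, hd]; ring
  have n1 : ¬ i ≤ -K - 1 := by omega
  have n2 : ¬ i = -K := by omega
  rcases le_or_gt i K with h' | h'
  · right
    have hrow : ∀ j, j ≠ i → Eqcf K φF φ2F i j = φ2F * (
        if j = i-1 then 1 else if j = i+1 then 1 else 0) := by
      intro j hj
      simp only [Eqcf, Bqcf, if_neg n1, if_neg n2, if_pos h', if_neg hj, if_neg hj.symm]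
      ring
    have hd : Eqcf K φF φ2F i i = φF + 2 * φ2F := by
      simp only [Eqcf, Bqcf, if_neg n1, if_neg n2, if_pos h', if_true,
        if_neg (show ¬ i = i - 1 by omega)]
      ring
    obtain ⟨e1, e2⟩ := row_two (Finset.Icc (-N+1) N) i (i-1) (i+1) (i+1) φ2F
      (fun j => min 0 (Eqcf K φF φ2F i j)) (fun j => max 0 (Eqcf K φF φ2F i j)) 0
      (hmem _ (by omega) (by omega)) (hmem _ (by omega) (by omega))
      (hmem _ (by omega) (by omega))
      (by intro j hj; simp only [hrow j hj]; split_ifs <;> first | omega | simp only [mul_one, mul_zero, add_zero, zero_add, min_self, max_self, m1, m2, m3, m4])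
      (by intro j hj; simp only [hrow j hj]; split_ifs <;> first | omega | simp only [mul_one, mul_zero, add_zero, zero_add, min_self, max_self, m1, m2, m3, m4])
    refine ⟨by omega, ?_, e2⟩
    rw [e1, hd]; ring
  have n3 : ¬ i ≤ K := by omega
  left
  by_cases h5 : i = K + 1
  · have hrow : ∀ j, j ≠ i → Eqcf K φF φ2F i j = φ2F * (
        if j = K-1 then 1 else if j = K then -2 else 0) := by
      intro j hj
      simp only [Eqcf, Bqcf, if_neg n1, if_neg n2, if_neg n3, if_pos h5, if_neg hj,
        if_neg hj.symm]
      ring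
    have hd : Eqcf K φF φ2F i i = φF + 5 * φ2F := by
      simp only [Eqcf, Bqcf, if_neg n1, if_neg n2, if_neg n3, if_pos h5, if_true,
        if_neg (show ¬ i = K - 1 by omega), if_neg (show ¬ i = K by omega)]
      ring
    obtain ⟨e1, e2⟩ := row_one (Finset.Icc (-N+1) N) i (K-1) K φ2F
      (fun j => min 0 (Eqcf K φF φ2F i j)) (fun j => max 0 (Eqcf K φF φ2F i j)) (-2 * φ2F)
      (hmem _ (by omega) (by omega)) (hmem _ (by omega) (by omega))
      (by intro j hj; simp only [hrow j hj]; split_ifs <;> first | omega | simp only [mul_one, mul_zero, add_zero, zero_add, min_self, max_self, m1, m2, m3, m4])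
      (by intro j hj; simp only [hrow j hj]; split_ifs <;> first | omega | simp only [mul_one, mul_zero, add_zero, zero_add, min_self, max_self, m1, m2, m3, m4])
    refine ⟨by omega, ?_, e2⟩
    rw [e1, hd]; ring
  · have hrow : ∀ j, j ≠ i → Eqcf K φF φ2F i j = φ2F * (
        if j = K-1 then 1 else if j = K then -2 else if j = K+1 then 1 else 0) := by
      intro j hj
      simp only [Eqcf, Bqcf, if_neg n1, if_neg n2, if_neg n3, if_neg h5, if_neg hj,
        if_neg hj.symm]
      ring
    have hd : Eqcf K φF φ2F i i = φF + 4 * φ2F := by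
      simp only [Eqcf, Bqcf, if_neg n1, if_neg n2, if_neg n3, if_neg h5, if_true,
        if_neg (show ¬ i = K - 1 by omega), if_neg (show ¬ i = K by omega)]
      ring
    obtain ⟨e1, e2⟩ := row_two (Finset.Icc (-N+1) N) i (K-1) (K+1) K φ2F
      (fun j => min 0 (Eqcf K φF φ2F i j)) (fun j => max 0 (Eqcf K φF φ2F i j)) (-2 * φ2F)
      (hmem _ (by omega) (by omega)) (hmem _ (by omega) (by omega))
      (hmem _ (by omega) (by omega))
      (by intro j hj; simp only [hrow j hj]; split_ifs <;> first | omega | simp only [mul_one, mul_zero, add_zero, zero_add, min_self, max_self, m1, m2, m3, m4])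
      (by intro j hj; simp only [hrow j hj]; split_ifs <;> first | omega | simp only [mul_one, mul_zero, add_zero, zero_add, min_self, max_self, m1, m2, m3, m4])
    refine ⟨by omega, ?_, e2⟩
    rw [e1, hd]; ring


/-- Diagonal dominance constant of `E^{qcf}`:
`min_i (E_ii + Σ_{j≠i} min(0,E_ij)) - max_i Σ_{j≠i} max(0,E_ij) = φ''_F + 8φ''_{2F}`
when `φ''_F > 0 > φ''_{2F}`. -/
theorem Eqcf_rdd_constant (N K : ℤ) (hN : 1 ≤ N) (hK : 2 ≤ K) (hKN : 2 * K ≤ N)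
    (hne : (Finset.Icc (-N+1) N).Nonempty)
    (φF φ2F : ℝ) (hF : 0 < φF) (h2F : φ2F < 0) :
    (Finset.Icc (-N+1) N).inf' hne
        (fun i => Eqcf K φF φ2F i i +
          ∑ j ∈ (Finset.Icc (-N+1) N).erase i, min 0 (Eqcf K φF φ2F i j))
      - (Finset.Icc (-N+1) N).sup' hne
        (fun i => ∑ j ∈ (Finset.Icc (-N+1) N).erase i, max 0 (Eqcf K φF φ2F i j))
      = φF + 8 * φ2F := by

  have hrows := Eqcf_rows N K hK hKN φF φ2F h2F
  have hmem : -K ∈ Finset.Icc (-N+1) N := Finset.mem_Icc.2 ⟨by omega, by omega⟩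
  obtain ⟨k1, k2⟩ : _ ∧ _ := by
    rcases hrows (-K) hmem with h | h
    · exact h.2
    · exact absurd h.1.1 (lt_irrefl _)
  have hmin : (Finset.Icc (-N+1) N).inf' hne
        (fun i => Eqcf K φF φ2F i i +
          ∑ j ∈ (Finset.Icc (-N+1) N).erase i, min 0 (Eqcf K φF φ2F i j)) = φF + 6 * φ2F := by
    apply le_antisymm
    · exact (Finset.inf'_le _ hmem).trans k1.le
    · refine Finset.le_inf' _ _ fun i hi => ?_
      rcases hrows i hi with h | h
      · exact h.2.1.ge
      · rw [h.2.1]; linarith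
  have hmax : (Finset.Icc (-N+1) N).sup' hne
        (fun i => ∑ j ∈ (Finset.Icc (-N+1) N).erase i, max 0 (Eqcf K φF φ2F i j))
        = -2 * φ2F := by
    apply le_antisymm
    · refine Finset.sup'_le _ _ fun i hi => ?_
      rcases hrows i hi with h | h
      · exact h.2.2.le
      · rw [h.2.2]; linarith
    · exact k2.ge.trans (Finset.le_sup' (fun i => ∑ j ∈ (Finset.Icc (-N+1) N).erase i,
        max 0 (Eqcf K φF φ2F i j)) hmem)
  rw [hmin, hmax]; ring
end
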